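/- Let A be m×n, B be m×p, and U an n×p matrix with U^T U = I_p. Then U is a critical point of U ↦ (1/2)‖AU - B‖_F² restricted to the Stiefel manifold (equivalently, ∇G(U) - UΣ(U) = 0 with ∇G(U) = A^TAU - A^TB) if and only if B^T A U is symmetric and (I_n - U U^T)(A^T A U - A^T B) = 0. -/

import Mathlib

open Matrix

theorem procrustes_critical_point_characterization {m n p : ℕ}
    (A : Matrix (Fin m) (Fin n) ℝ) (B : Matrix (Fin m) (Fin p) ℝ)
    (U : Matrix (Fin n) (Fin p) ℝ) (hU : Uᵀ * U = 1) :
    ((Aᵀ * A * U - Aᵀ * B) -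
        U * ((1 / 2 : ℝ) •
          ((Aᵀ * A * U - Aᵀ * B)ᵀ * U + Uᵀ * (Aᵀ * A * U - Aᵀ * B))) = 0) ↔
      ((Bᵀ * A * U)ᵀ = Bᵀ * A * U ∧
        (1 - U * Uᵀ) * (Aᵀ * A * U - Aᵀ * B) = 0) := by
  have key : (Aᵀ * A * U - Aᵀ * B)ᵀ * U - Uᵀ * (Aᵀ * A * U - Aᵀ * B)
      = (Bᵀ * A * U)ᵀ - Bᵀ * A * U := by
    simp only [transpose_sub, transpose_mul, transpose_transpose, Matrix.sub_mul,
      Matrix.mul_sub, Matrix.mul_assoc]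
    abel
  generalize Aᵀ * A * U - Aᵀ * B = G at key ⊢
  have hsym : (Bᵀ * A * U)ᵀ = Bᵀ * A * U ↔ Gᵀ * U = Uᵀ * G := by
    rw [← sub_eq_zero, ← key, sub_eq_zero]
  have half : ∀ S : Matrix (Fin p) (Fin p) ℝ, (1 / 2 : ℝ) • (S + S) = S := by
    intro S
    rw [← two_smul ℝ S, smul_smul]
    norm_num
  rw [hsym]
  constructor
  · intro h
    have h1 : Gᵀ * U = Uᵀ * G := by
      have h2 := congrArg (fun M => Uᵀ * M) h
      simp only [Matrix.mul_sub, Matrix.mul_zero] at h2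
      rw [← Matrix.mul_assoc, hU, Matrix.one_mul] at h2
      ext i j
      have h3 := congrFun (congrFun h2 i) j
      simp only [Matrix.sub_apply, Matrix.smul_apply, Matrix.add_apply, smul_eq_mul,
        Matrix.zero_apply] at h3
      linarith
    refine ⟨h1, ?_⟩
    rw [h1, half] at h
    rw [Matrix.sub_mul, Matrix.one_mul, Matrix.mul_assoc]
    exact h
  · rintro ⟨h1, h2⟩
    rw [h1, half]
    rw [Matrix.sub_mul, Matrix.one_mul, Matrix.mul_assoc] at h2
    exact h2
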